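/- Let μ > 0 and let (u_μ, v_μ) be the solution of (S2) with u_μ(0) = v_μ(0) = μ. If u_μ changes sign only a finite number of times on ℝ, then there exists T > 0 such that u_μ(t)·v_μ(t) > 0 for all |t| ≥ T. -/

import Mathlib

open Real Filter Set Topology

noncomputable section

/-- System (S2): `u' + ((m-2)/2) u = cosh(t)^{-1/(m-1)} (u²+v²)^{1/(m-1)} v`,
    `-v' + ((m-2)/2) v = cosh(t)^{-1/(m-1)} (u²+v²)^{1/(m-1)} u`. -/
def IsSolS2 (m : ℕ) (u v : ℝ → ℝ) : Prop :=
  ∀ t : ℝ,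
    HasDerivAt u (Real.cosh t ^ (-(1 : ℝ) / ((m : ℝ) - 1))
        * ((u t) ^ 2 + (v t) ^ 2) ^ ((1 : ℝ) / ((m : ℝ) - 1)) * v t
      - (((m : ℝ) - 2) / 2) * u t) t ∧
    HasDerivAt v ((((m : ℝ) - 2) / 2) * v t
      - Real.cosh t ^ (-(1 : ℝ) / ((m : ℝ) - 1))
        * ((u t) ^ 2 + (v t) ^ 2) ^ ((1 : ℝ) / ((m : ℝ) - 1)) * u t) t

/-- The (time-dependent) energy of (S2). -/
def H2 (m : ℕ) (t u v : ℝ) : ℝ :=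
  -(((m : ℝ) - 2) / 2) * u * v
    + (((m : ℝ) - 1) / (2 * (m : ℝ))) * Real.cosh t ^ (-(1 : ℝ) / ((m : ℝ) - 1))
      * (u ^ 2 + v ^ 2) ^ ((m : ℝ) / ((m : ℝ) - 1))

/-- `w` changes sign at least `k` times on `J`. -/
def ChangesSignAtLeast (w : ℝ → ℝ) (J : Set ℝ) (k : ℕ) : Prop :=
  ∃ s : ℕ → ℝ, (∀ i, i ≤ k → s i ∈ J) ∧
    (∀ i j, i < j → j ≤ k → s i < s j) ∧
    (∀ i, i + 1 ≤ k → w (s i) * w (s (i + 1)) < 0)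

/-- `w` changes sign exactly `k` times on `J`. -/
def ChangesSignExactly (w : ℝ → ℝ) (J : Set ℝ) (k : ℕ) : Prop :=
  ChangesSignAtLeast w J k ∧ ¬ ChangesSignAtLeast w J (k + 1)

theorem sol_neg {m : ℕ} {u v : ℝ → ℝ} (h : IsSolS2 m u v) :
    IsSolS2 m (fun t => - u t) (fun t => - v t) := by
  intro t
  obtain ⟨h1, h2⟩ := h t
  refine ⟨?_, ?_⟩
  · refine HasDerivAt.congr_deriv h1.neg ?_
    simp only [neg_sq]; ring
  · refine HasDerivAt.congr_deriv h2.neg ?_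
    simp only [neg_sq]; ring

theorem sol_rev {m : ℕ} {u v : ℝ → ℝ} (h : IsSolS2 m u v) :
    IsSolS2 m (fun t => v (-t)) (fun t => u (-t)) := by
  intro t
  obtain ⟨h1, h2⟩ := h (-t)
  refine ⟨?_, ?_⟩
  · have := HasDerivAt.scomp t h2 (hasDerivAt_neg t)
    refine HasDerivAt.congr_deriv this ?_
    rw [Real.cosh_neg, smul_eq_mul, add_comm ((v (-t))^2)]; ring
  · have := HasDerivAt.scomp t h1 (hasDerivAt_neg t)
    refine HasDerivAt.congr_deriv this ?_
    rw [Real.cosh_neg, smul_eq_mul, add_comm ((v (-t))^2)]; ring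

theorem hasDerivAt_expmul (a t : ℝ) : HasDerivAt (fun s => Real.exp (a * s)) (a * Real.exp (a * t)) t := by
  have := ((hasDerivAt_id t).const_mul a).exp
  simpa [mul_comm] using this

theorem sol_du {m : ℕ} {u v : ℝ → ℝ} (h : IsSolS2 m u v) (t : ℝ) :
    HasDerivAt (fun s => u s * Real.exp ((((m : ℝ) - 2) / 2) * s))
      (Real.cosh t ^ (-(1 : ℝ) / ((m : ℝ) - 1))
        * ((u t) ^ 2 + (v t) ^ 2) ^ ((1 : ℝ) / ((m : ℝ) - 1)) * v t *
          Real.exp ((((m : ℝ) - 2) / 2) * t)) t := by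
  refine HasDerivAt.congr_deriv ((h t).1.mul (hasDerivAt_expmul (((m : ℝ) - 2) / 2) t)) ?_
  ring

theorem sol_dv {m : ℕ} {u v : ℝ → ℝ} (h : IsSolS2 m u v) (t : ℝ) :
    HasDerivAt (fun s => v s * Real.exp ((-(((m : ℝ) - 2) / 2)) * s))
      (-(Real.cosh t ^ (-(1 : ℝ) / ((m : ℝ) - 1))
        * ((u t) ^ 2 + (v t) ^ 2) ^ ((1 : ℝ) / ((m : ℝ) - 1)) * u t *
          Real.exp ((-(((m : ℝ) - 2) / 2)) * t))) t := by
  refine HasDerivAt.congr_deriv ((h t).2.mul (hasDerivAt_expmul (-(((m : ℝ) - 2) / 2)) t)) ?_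
  ring

theorem sol_pos {m : ℕ} (hm : 3 ≤ m) {u v : ℝ → ℝ} (h : IsSolS2 m u v)
    (h0 : 0 < u 0 ^ 2 + v 0 ^ 2) (t : ℝ) (ht : 0 ≤ t) : 0 < u t ^ 2 + v t ^ 2 := by
  have hm' : (3 : ℝ) ≤ m := by exact_mod_cast hm
  have hd : ∀ s, HasDerivAt (fun s => (u s ^ 2 + v s ^ 2) * Real.exp (((m : ℝ) - 2) * s))
      (2 * ((m : ℝ) - 2) * v s ^ 2 * Real.exp (((m : ℝ) - 2) * s)) s := by
    intro s
    refine HasDerivAt.congr_deriv ((((h s).1.pow 2).add ((h s).2.pow 2)).mul (hasDerivAt_expmul ((m : ℝ) - 2) s)) ?_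
    simp only [Pi.add_apply, Pi.pow_apply]
    push_cast
    ring
  have hmono := monotone_of_deriv_nonneg (fun s => (hd s).differentiableAt) (fun s => by
    rw [(hd s).deriv]
    have : 0 ≤ (m : ℝ) - 2 := by linarith
    positivity)
  have := hmono ht
  simp only [mul_zero, Real.exp_zero, mul_one] at this
  exact pos_of_mul_pos_left (h0.trans_le this) (Real.exp_pos _).le

theorem fac_pos {m : ℕ} {t x : ℝ} (hx : 0 < x) : 0 < Real.cosh t ^ (-(1 : ℝ) / ((m : ℝ) - 1))
        * x ^ ((1 : ℝ) / ((m : ℝ) - 1)) :=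
  mul_pos (Real.rpow_pos_of_pos (Real.cosh_pos t) _) (Real.rpow_pos_of_pos hx _)

theorem strictAnti_of {g g' : ℝ → ℝ} {T : ℝ} (hd : ∀ s, HasDerivAt g (g' s) s)
    (hn : ∀ s, T < s → g' s < 0) : StrictAntiOn g (Set.Ici T) := by
  apply strictAntiOn_of_deriv_neg (convex_Ici T)
  · exact fun s _ => (hd s).continuousAt.continuousWithinAt
  · intro s hs
    rw [interior_Ici] at hs
    rw [(hd s).deriv]; exact hn s hs

theorem no_bad {m : ℕ} (hm : 3 ≤ m) {u v : ℝ → ℝ} (h : IsSolS2 m u v) (T : ℝ) (hT : 0 ≤ T)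
    (hu : ∀ t, T < t → 0 < u t) (hv : ∀ t, T < t → v t < 0) : False := by
  have hm' : (3 : ℝ) ≤ m := by exact_mod_cast hm
  have ha := strictAnti_of (T := T) (fun s => sol_dv h s) (fun s hs => by
    have := hu s hs
    have hr : 0 < u s ^ 2 + v s ^ 2 := by positivity
    have := fac_pos (m := m) (t := s) hr
    have h3 := hu s hs
    have := mul_pos (mul_pos this h3) (Real.exp_pos (-(((m : ℝ) - 2) / 2) * s))
    linarith)
  set T1 := T + 1 with hT1
  obtain ⟨w, hw⟩ : ∃ w, w = - (v T1 * Real.exp ((-(((m : ℝ) - 2) / 2)) * T1)) := ⟨_, rfl⟩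
  have hwpos : 0 < w := by
    have := mul_pos (neg_pos.2 (hv T1 (by linarith))) (Real.exp_pos ((-(((m : ℝ) - 2) / 2)) * T1))
    rw [hw]; linarith
  have hvle : ∀ t, T1 ≤ t → w * Real.exp ((((m : ℝ) - 2) / 2) * t) ≤ - v t := by
    intro t ht
    have h1 := ha.antitoneOn (a := T1) (b := t) (by simp [hT1]) (by simp; linarith) ht
    have h2 : w ≤ - v t * Real.exp ((-(((m : ℝ) - 2) / 2)) * t) := by rw [hw]; linarith
    calc _ ≤ (- v t * Real.exp ((-(((m : ℝ) - 2) / 2)) * t)) * Real.exp ((((m : ℝ) - 2) / 2) * t) := by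
          gcongr
      _ = _ := by
          rw [mul_assoc, ← Real.exp_add]
          simp
  obtain ⟨p, hp⟩ : ∃ p, p = (1 : ℝ) / ((m : ℝ) - 1) := ⟨_, rfl⟩
  have hp0 : 0 < p := by rw [hp]; apply one_div_pos.2; linarith
  have hf : ∀ t, T1 ≤ t → (w ^ 2) ^ p ≤ Real.cosh t ^ (-(1 : ℝ) / ((m : ℝ) - 1))
        * ((u t) ^ 2 + (v t) ^ 2) ^ ((1 : ℝ) / ((m : ℝ) - 1)) := by
    intro t ht
    have e : -(1 : ℝ) / ((m : ℝ) - 1) = - p := by rw [hp]; ring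
    rw [e, ← hp, Real.rpow_neg (Real.cosh_pos t).le, ← div_eq_inv_mul,
      ← Real.div_rpow (by positivity) (Real.cosh_pos t).le]
    apply Real.rpow_le_rpow (by positivity) _ hp0.le
    rw [le_div_iff₀ (Real.cosh_pos t)]
    have ht0 : 0 ≤ t := by linarith
    have hc : Real.cosh t ≤ Real.exp t := by
      rw [Real.cosh_eq]
      have : Real.exp (-t) ≤ Real.exp t := Real.exp_le_exp.2 (by linarith)
      linarith
    have h1 := hvle t ht
    have h2 : Real.exp t ≤ (Real.exp ((((m : ℝ) - 2) / 2) * t)) ^ 2 := by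
      rw [← Real.exp_nat_mul]
      apply Real.exp_le_exp.2
      push_cast
      nlinarith
    have h3 : (w * Real.exp ((((m : ℝ) - 2) / 2) * t)) ^ 2 ≤ (- v t) ^ 2 := by
      gcongr
    calc w ^ 2 * Real.cosh t ≤ w ^ 2 * (Real.exp ((((m : ℝ) - 2) / 2) * t)) ^ 2 := by
          gcongr; exact hc.trans h2
      _ = (w * Real.exp ((((m : ℝ) - 2) / 2) * t)) ^ 2 := by ring
      _ ≤ _ := by nlinarith [sq_nonneg (u t)]
  obtain ⟨d, hd⟩ : ∃ d, d = (w ^ 2) ^ p * w := ⟨_, rfl⟩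
  have hdpos : 0 < d := by rw [hd]; positivity
  have hanti : AntitoneOn (fun s => u s + d * s) (Set.Ici T1) := by
    have hD : ∀ s, HasDerivAt (fun s => u s + d * s) _ s :=
      fun s => (h s).1.add ((hasDerivAt_id s).const_mul d)
    apply antitoneOn_of_deriv_nonpos (convex_Ici T1)
    · exact fun s _ => (hD s).continuousAt.continuousWithinAt
    · exact fun s _ => (hD s).differentiableAt.differentiableWithinAt
    · intro s hs
      rw [interior_Ici] at hs
      rw [(hD s).deriv]
      have hs' : T1 < s := hs
      have h1 := hf s hs'.le
      have h2 := hvle s hs'.le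
      have h3 : 1 ≤ Real.exp ((((m : ℝ) - 2) / 2) * s) := by
        apply Real.one_le_exp
        have : 0 ≤ s := by linarith
        have : 0 ≤ (m : ℝ) - 2 := by linarith
        positivity
      have h4 : w ≤ - v s := by nlinarith
      have h5 : d ≤ (Real.cosh s ^ (-(1 : ℝ) / ((m : ℝ) - 1))
        * ((u s) ^ 2 + (v s) ^ 2) ^ ((1 : ℝ) / ((m : ℝ) - 1))) * (- v s) := by
        rw [hd]
        apply mul_le_mul h1 h4 hwpos.le
        exact le_trans (by positivity) h1
      have h6 : 0 ≤ (((m : ℝ) - 2) / 2) * u s :=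
        mul_nonneg (by linarith) (hu s (by linarith)).le
      linarith
  have hu1 := hu T1 (by linarith)
  have h1 := hanti (a := T1) (b := T1 + u T1 / d) (by simp) (by simp; positivity) (by simp; positivity)
  simp only at h1
  have h2 := hu (T1 + u T1 / d) (by have : 0 < u T1 / d := by positivity
                                    linarith)
  rw [mul_add, mul_div_cancel₀ _ hdpos.ne'] at h1
  linarith

theorem caseA {m : ℕ} (hm : 3 ≤ m) {u v : ℝ → ℝ} (h : IsSolS2 m u v) (T : ℝ) (hT : 0 ≤ T)
    (h0 : 0 < u 0 ^ 2 + v 0 ^ 2)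
    (hu : ∀ t, T ≤ t → 0 ≤ u t) : ∃ T', ∀ t, T' ≤ t → 0 < u t * v t := by
  have hup : ∀ t, T < t → 0 < u t := by
    intro t ht
    rcases (hu t ht.le).lt_or_eq with h1 | h1
    · exact h1
    exfalso
    have hmin : IsLocalMin u t := by
      filter_upwards [lt_mem_nhds ht] with s hs
      rw [← h1]; exact hu s hs.le
    have h2 := hmin.hasDerivAt_eq_zero (h t).1
    have hr := sol_pos hm h h0 t (by linarith)
    have h3 := fac_pos (m := m) (t := t) hr
    rw [← h1] at h2 h3 hr
    have hv : v t = 0 := by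
      rw [mul_zero, sub_zero] at h2
      exact (mul_eq_zero.1 h2).resolve_left h3.ne'
    simp [hv] at hr
  by_cases hv : ∀ t, T < t → 0 < v t
  · exact ⟨T + 1, fun t ht => mul_pos (hup t (by linarith)) (hv t (by linarith))⟩
  push Not at hv
  obtain ⟨t1, ht1, hv1⟩ := hv
  exfalso
  have ha := strictAnti_of (T := T) (fun s => sol_dv h s) (fun s hs => by
    have h3 := hup s hs
    have hr : 0 < u s ^ 2 + v s ^ 2 := by positivity
    have := fac_pos (m := m) (t := s) hr
    have := mul_pos (mul_pos this h3) (Real.exp_pos (-(((m : ℝ) - 2) / 2) * s))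
    linarith)
  refine no_bad hm h t1 (by linarith) (fun t ht => hup t (by linarith)) (fun t ht => ?_)
  have h1 := ha (a := t1) (b := t) (by simp; linarith) (by simp; linarith) ht
  simp only at h1
  have h2 := mul_nonneg (neg_nonneg.2 hv1) (Real.exp_pos (-(((m : ℝ) - 2) / 2) * t1)).le
  by_contra hc
  have h4 := mul_nonneg (not_lt.1 hc) (Real.exp_pos (-(((m : ℝ) - 2) / 2) * t)).le
  linarith

theorem caseB {m : ℕ} (hm : 3 ≤ m) {u v : ℝ → ℝ} (h : IsSolS2 m u v) (T : ℝ) (hT : 0 ≤ T)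
    (h0 : 0 < u 0 ^ 2 + v 0 ^ 2)
    (hv : ∀ t, T ≤ t → 0 ≤ v t) : ∃ T', ∀ t, T' ≤ t → 0 < u t * v t := by
  have hvp : ∀ t, T < t → 0 < v t := by
    intro t ht
    rcases (hv t ht.le).lt_or_eq with h1 | h1
    · exact h1
    exfalso
    have hmin : IsLocalMin v t := by
      filter_upwards [lt_mem_nhds ht] with s hs
      rw [← h1]; exact hv s hs.le
    have h2 := hmin.hasDerivAt_eq_zero (h t).2
    have hr := sol_pos hm h h0 t (by linarith)
    have h3 := fac_pos (m := m) (t := t) hr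
    rw [← h1] at h2 h3 hr
    have hv : u t = 0 := by
      rw [mul_zero, zero_sub, neg_eq_zero] at h2
      exact (mul_eq_zero.1 h2).resolve_left h3.ne'
    simp [hv] at hr
  by_cases hu : ∀ t, T < t → u t < 0
  · exact (no_bad hm (sol_neg h) T hT (fun t ht => neg_pos.2 (hu t ht))
      (fun t ht => neg_neg_of_pos (hvp t ht))).elim
  push Not at hu
  obtain ⟨t1, ht1, hu1⟩ := hu
  have ha := strictAnti_of (T := T) (fun s => (sol_du h s).neg) (fun s hs => by
    have h3 := hvp s hs
    have hr : 0 < u s ^ 2 + v s ^ 2 := by positivity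
    have := fac_pos (m := m) (t := s) hr
    have := mul_pos (mul_pos this h3) (Real.exp_pos ((((m : ℝ) - 2) / 2) * s))
    linarith)
  refine ⟨t1 + 1, fun t ht => mul_pos ?_ (hvp t (by linarith))⟩
  have h1 := ha (a := t1) (b := t) (by simp; linarith) (by simp; linarith) (by linarith)
  simp only [Pi.neg_apply] at h1
  have h2 := mul_nonneg hu1 (Real.exp_pos ((((m : ℝ) - 2) / 2) * t1)).le
  exact pos_of_mul_pos_left (b := Real.exp ((((m : ℝ) - 2) / 2) * t)) (by linarith) (Real.exp_pos _).le

theorem ev_sign {w : ℝ → ℝ} {k : ℕ} (hk : ¬ ChangesSignAtLeast w Set.univ k) :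
    ∃ T, 0 ≤ T ∧ ((∀ t, T ≤ t → 0 ≤ w t) ∨ (∀ t, T ≤ t → 0 ≤ - w t)) := by
  by_contra hc
  push Not at hc
  apply hk
  have key : ∀ x : {x : ℝ // w x ≠ 0}, ∃ y : {x : ℝ // w x ≠ 0}, x.1 < y.1 ∧ w x.1 * w y.1 < 0 := by
    rintro ⟨x, hx⟩
    obtain ⟨⟨y, hy, hy1⟩, ⟨z, hz, hz1⟩⟩ := hc (max 0 (x + 1)) (le_max_left _ _)
    have := le_max_right 0 (x + 1)
    rcases lt_or_gt_of_ne hx with h | h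
    · exact ⟨⟨z, by intro h; simp [h] at hz1⟩, by simp; linarith, by
        simp only; exact mul_neg_of_neg_of_pos h (by linarith)⟩
    · exact ⟨⟨y, hy1.ne⟩, by simp; linarith, mul_neg_of_pos_of_neg h hy1⟩
  choose F hF1 hF2 using key
  obtain ⟨⟨y, hy, hy1⟩, -⟩ := hc 0 le_rfl
  let S : ℕ → {x : ℝ // w x ≠ 0} := fun n => Nat.rec ⟨y, hy1.ne⟩ (fun _ x => F x) n
  have hS : StrictMono (fun n => (S n).1) := strictMono_nat_of_lt_succ (fun n => hF1 (S n))
  exact ⟨fun n => (S n).1, fun _ _ => Set.mem_univ _, fun i j hij _ => hS hij, fun i _ => hF2 (S i)⟩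

theorem csal_neg {w : ℝ → ℝ} {k : ℕ} (h : ChangesSignAtLeast (fun t => w (-t)) Set.univ k) :
    ChangesSignAtLeast w Set.univ k := by
  obtain ⟨s, -, h2, h3⟩ := h
  refine ⟨fun i => - s (k - i), fun _ _ => Set.mem_univ _, fun i j hij hj => ?_, fun i hi => ?_⟩
  · exact neg_lt_neg (h2 _ _ (by omega) (by omega))
  · have := h3 (k - (i + 1)) (by omega)
    rw [show k - (i + 1) + 1 = k - i by omega] at this
    rw [mul_comm]; exact this

theorem stmt13 (m : ℕ) (hm : 3 ≤ m) (μ : ℝ) (hμ : 0 < μ)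
    (u v : ℝ → ℝ) (hsol : IsSolS2 m u v) (hu0 : u 0 = μ) (hv0 : v 0 = μ)
    (hfin : ∃ k : ℕ, ¬ ChangesSignAtLeast u Set.univ k) :
    ∃ T : ℝ, 0 < T ∧ ∀ t : ℝ, T ≤ |t| → 0 < u t * v t := by
  obtain ⟨k, hk⟩ := hfin
  have h0 : 0 < u 0 ^ 2 + v 0 ^ 2 := by rw [hu0, hv0]; positivity
  have hP : ∃ T', ∀ t, T' ≤ t → 0 < u t * v t := by
    obtain ⟨T, hT, h | h⟩ := ev_sign hk
    · exact caseA hm hsol T hT h0 h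
    · obtain ⟨T', h'⟩ := caseA hm (sol_neg hsol) T hT (by simpa using h0) h
      exact ⟨T', fun t ht => by simpa using h' t ht⟩
  have hN : ∃ T', ∀ t, T' ≤ t → 0 < v (-t) * u (-t) := by
    obtain ⟨T, hT, h | h⟩ := ev_sign (fun h => hk (csal_neg h))
    · exact caseB hm (sol_rev hsol) T hT (by simpa [add_comm] using h0) h
    · obtain ⟨T', h'⟩ := caseB hm (sol_neg (sol_rev hsol)) T hT (by simpa [add_comm] using h0) h
      exact ⟨T', fun t ht => by simpa using h' t ht⟩
  obtain ⟨T1, h1⟩ := hP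
  obtain ⟨T2, h2⟩ := hN
  refine ⟨max 1 (max T1 T2), by positivity, fun t ht => ?_⟩
  have ha := (le_max_left T1 T2).trans ((le_max_right 1 _).trans ht)
  have hb := (le_max_right T1 T2).trans ((le_max_right 1 _).trans ht)
  rcases le_total 0 t with h | h
  · rw [abs_of_nonneg h] at ha; exact h1 t ha
  · rw [abs_of_nonpos h] at hb
    have := h2 (-t) hb
    rw [neg_neg] at this; linarith
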